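/- Let l ≥ 2 be an integer. Then every finite simple graph G with exactly m edges contains at most m^{l+1} / (4·l^l) induced copies of the path P_{2l+1} on 2l+1 vertices. -/

import Mathlib

open SimpleGraph

/-- Number of induced copies of `H` in `G`: vertex subsets of `G` whose induced
subgraph is isomorphic to `H`. -/
noncomputable def inducedCopies {V W : Type*} [Fintype V] [Fintype W]
    (G : SimpleGraph V) (H : SimpleGraph W) : ℕ :=
  {S : Finset V | Nonempty ((G.induce (S : Set V)) ≃g H)}.ncard

/-- The fractional independence number of a finite simple graph `H`. -/
noncomputable def fracIndepNum {V : Type*} [Fintype V] (H : SimpleGraph V) : ℝ :=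
  sSup {x : ℝ | ∃ ω : V → ℝ, (∀ v, 0 ≤ ω v ∧ ω v ≤ 1) ∧
    (∀ u v, H.Adj u v → ω u + ω v ≤ 1) ∧ x = ∑ v, ω v}

/-- The set of vertices adjacent to at least one vertex of `S`. -/
def finNbhd {V : Type*} [Fintype V] (H : SimpleGraph V) [DecidableRel H.Adj]
    (S : Finset V) : Finset V :=
  Finset.univ.filter (fun v => ∃ u ∈ S, H.Adj u v)

/-- Weighted AM-GM with weights `1` and `k`. -/
lemma mul_pow_mul_succ_pow_le (k d r : ℕ) :
    d * r ^ k * (k + 1) ^ (k + 1) ≤ k ^ k * (d + r) ^ (k + 1) := by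
  rcases Nat.eq_zero_or_pos k with rfl | hk
  · simp
  rcases Nat.eq_zero_or_pos r with rfl | hr
  · simp [hk.ne']
  have hk' : (0 : ℝ) < k := by exact_mod_cast hk
  have hr' : (0 : ℝ) < r := by exact_mod_cast hr
  have hB := one_add_mul_le_pow
    (a := ((d : ℝ) + r) * k / ((k + 1) * r) - 1)
    (by
      have : 0 ≤ ((d : ℝ) + r) * k / ((k + 1) * r) := by positivity
      linarith) (k + 1)
  have h1 : 1 + ((k + 1 : ℕ) : ℝ) * (((d : ℝ) + r) * k / ((k + 1) * r) - 1) = d * k / r := by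
    push_cast
    field_simp
    ring
  rw [h1, add_sub_cancel, div_pow, mul_pow, mul_pow, div_le_div_iff₀ hr' (by positivity)] at hB
  have h2 : ((d : ℝ) * r ^ k * (k + 1) ^ (k + 1)) * (k * r) ≤
      (k ^ k * (d + r) ^ (k + 1)) * (k * r) := by
    calc _ = (d : ℝ) * k * ((k + 1) ^ (k + 1) * r ^ (k + 1)) := by ring
      _ ≤ (d + r) ^ (k + 1) * k ^ (k + 1) * r := hB
      _ = _ := by ring
  exact_mod_cast le_of_mul_le_mul_right h2 (by positivity)

/-- A family of `l`-tuples in `E`, in which the entries available at a position after a given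
prefix never occur later in a tuple with that prefix, has at most `(|E| / l) ^ l` members. -/
lemma card_mul_pow_le_of_prefix_disjoint {α : Type*} (l : ℕ) (T : Finset (Fin l → α))
    (E : Finset α) (hE : ∀ t ∈ T, ∀ i, t i ∈ E)
    (hT : ∀ s ∈ T, ∀ t ∈ T, ∀ i j, i < j → (∀ k < i, s k = t k) → s i ≠ t j) :
    T.card * l ^ l ≤ E.card ^ l := by
  classical
  induction l generalizing E with
  | zero =>
    simpa using Finset.card_le_one_of_subsingleton T
  | succ l ih =>
    set D := T.image (fun t => t 0) with hD
    have hDE : D ⊆ E := by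
      intro x hx
      obtain ⟨t, ht, rfl⟩ := Finset.mem_image.1 hx
      exact hE t ht 0
    have hfib : ∀ a ∈ D, (T.filter (fun t => t 0 = a)).card * l ^ l ≤ (E \ D).card ^ l := by
      intro a _
      have hcard : ((T.filter (fun t => t 0 = a)).image Fin.tail).card =
          (T.filter (fun t => t 0 = a)).card := by
        apply Finset.card_image_of_injOn
        intro s hs t ht h
        simp only [Finset.coe_filter, Set.mem_ofPred_eq] at hs ht
        rw [← Fin.cons_self_tail s, ← Fin.cons_self_tail t, h, hs.2, ht.2]
      rw [← hcard]
      apply ih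
      · intro t' ht' i
        obtain ⟨t, ht, rfl⟩ := Finset.mem_image.1 ht'
        have ht := (Finset.mem_filter.1 ht).1
        refine Finset.mem_sdiff.2 ⟨hE t ht _, fun hmem => ?_⟩
        obtain ⟨s, hs, hst⟩ := Finset.mem_image.1 hmem
        exact hT s hs t ht 0 i.succ (Fin.succ_pos i) (fun k hk => absurd hk (Fin.not_lt_zero k)) hst
      · intro s' hs' t' ht' i j hij hk
        obtain ⟨s, hs, rfl⟩ := Finset.mem_image.1 hs'
        obtain ⟨t, ht, rfl⟩ := Finset.mem_image.1 ht'
        obtain ⟨hs, hs0⟩ := Finset.mem_filter.1 hs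
        obtain ⟨ht, ht0⟩ := Finset.mem_filter.1 ht
        refine hT s hs t ht i.succ j.succ (Fin.succ_lt_succ_iff.2 hij) (fun k => ?_)
        refine Fin.cases (fun _ => hs0.trans ht0.symm) (fun k h => ?_) k
        exact hk k (Fin.succ_lt_succ_iff.1 h)
    have hsum : T.card * l ^ l ≤ D.card * (E \ D).card ^ l := by
      rw [Finset.card_eq_sum_card_image (fun t => t 0) T, Finset.sum_mul, ← smul_eq_mul]
      exact Finset.sum_le_card_nsmul _ _ _ hfib
    have hpos : 0 < l ^ l := Nat.pow_self_pos
    have hamgm := mul_pow_mul_succ_pow_le l D.card (E \ D).card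
    rw [add_comm D.card, Finset.card_sdiff_add_card_eq_card hDE] at hamgm
    refine le_of_mul_le_mul_left ?_ hpos
    calc l ^ l * (T.card * (l + 1) ^ (l + 1)) = (T.card * l ^ l) * (l + 1) ^ (l + 1) := by ring
      _ ≤ (D.card * (E \ D).card ^ l) * (l + 1) ^ (l + 1) := Nat.mul_le_mul_right _ hsum
      _ ≤ _ := hamgm

/-- Variant of `card_mul_pow_le_of_prefix_disjoint` with an unconstrained first entry. -/
lemma card_mul_pow_le_of_prefix_disjoint_tail {α : Type*} (l : ℕ)
    (T : Finset (Fin (l + 1) → α)) (E : Finset α) (hE : ∀ t ∈ T, ∀ i, t i ∈ E)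
    (hT : ∀ s ∈ T, ∀ t ∈ T, ∀ i j, 0 < i → i < j → (∀ k < i, s k = t k) → s i ≠ t j) :
    T.card * l ^ l ≤ E.card ^ (l + 1) := by
  classical
  have hfib : ∀ a ∈ E, (T.filter (fun t => t 0 = a)).card * l ^ l ≤ E.card ^ l := by
    intro a _
    have hcard : ((T.filter (fun t => t 0 = a)).image Fin.tail).card =
        (T.filter (fun t => t 0 = a)).card := by
      apply Finset.card_image_of_injOn
      intro s hs t ht h
      simp only [Finset.coe_filter, Set.mem_ofPred_eq] at hs ht
      rw [← Fin.cons_self_tail s, ← Fin.cons_self_tail t, h, hs.2, ht.2]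
    rw [← hcard]
    apply card_mul_pow_le_of_prefix_disjoint
    · intro t' ht' i
      obtain ⟨t, ht, rfl⟩ := Finset.mem_image.1 ht'
      exact hE t (Finset.mem_filter.1 ht).1 _
    · intro s' hs' t' ht' i j hij hk
      obtain ⟨s, hs, rfl⟩ := Finset.mem_image.1 hs'
      obtain ⟨t, ht, rfl⟩ := Finset.mem_image.1 ht'
      obtain ⟨hs, hs0⟩ := Finset.mem_filter.1 hs
      obtain ⟨ht, ht0⟩ := Finset.mem_filter.1 ht
      refine hT s hs t ht i.succ j.succ (Fin.succ_pos i) (Fin.succ_lt_succ_iff.2 hij) (fun k => ?_)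
      refine Fin.cases (fun _ => hs0.trans ht0.symm) (fun k h => ?_) k
      exact hk k (Fin.succ_lt_succ_iff.1 h)
  rw [Finset.card_eq_sum_card_fiberwise (f := fun t : Fin (l + 1) → α => t 0) (t := E)
    (fun t ht => hE t ht 0), Finset.sum_mul, pow_succ', ← smul_eq_mul (a := E.card)]
  exact Finset.sum_le_card_nsmul _ _ _ hfib

/-- `p 0, …, p n` are the consecutive vertices of an induced path of `G`. -/
def IsInducedPathSeq {V : Type*} (G : SimpleGraph V) (n : ℕ) (p : ℕ → V) : Prop :=
  ∀ i ≤ n, ∀ j ≤ n, (p i = p j → i = j) ∧ (G.Adj (p i) (p j) ↔ i + 1 = j ∨ j + 1 = i)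

lemma IsInducedPathSeq.reverse {V : Type*} {G : SimpleGraph V} {n : ℕ} {p : ℕ → V}
    (hp : IsInducedPathSeq G n p) : IsInducedPathSeq G n (fun i => p (n - i)) := by
  intro i hi j hj
  obtain ⟨h1, h2⟩ := hp (n - i) (by omega) (n - j) (by omega)
  refine ⟨fun h => ?_, h2.trans ?_⟩
  · have := h1 h
    omega
  · omega

lemma exists_isInducedPathSeq {V : Type*} (G : SimpleGraph V) (n : ℕ) (S : Finset V)
    (hS : Nonempty ((G.induce (S : Set V)) ≃g SimpleGraph.pathGraph (n + 1))) :
    ∃ p : ℕ → V, IsInducedPathSeq G n p ∧ ∀ v, v ∈ S ↔ ∃ i ≤ n, p i = v := by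
  obtain ⟨φ⟩ := hS
  refine ⟨fun i => (φ.symm (Fin.ofNat (n + 1) i) : V), ?_, fun v => ⟨fun hv => ?_, ?_⟩⟩
  · intro i hi j hj
    have hi' : (Fin.ofNat (n + 1) i).val = i := Nat.mod_eq_of_lt (by omega)
    have hj' : (Fin.ofNat (n + 1) j).val = j := Nat.mod_eq_of_lt (by omega)
    constructor
    · intro h
      have := φ.symm.injective (Subtype.ext h)
      rw [← hi', ← hj', this]
    · have h := φ.symm.map_adj_iff (v := Fin.ofNat (n + 1) i) (w := Fin.ofNat (n + 1) j)
      rw [SimpleGraph.pathGraph_adj, hi', hj'] at h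
      exact h
  · refine ⟨(φ ⟨v, hv⟩).val, Nat.lt_succ_iff.1 (φ ⟨v, hv⟩).isLt, ?_⟩
    have : Fin.ofNat (n + 1) (φ ⟨v, hv⟩).val = φ ⟨v, hv⟩ :=
      Fin.ext (Nat.mod_eq_of_lt (φ ⟨v, hv⟩).isLt)
    simp only [this, RelIso.symm_apply_apply]
  · rintro ⟨i, _, rfl⟩
    exact (φ.symm (Fin.ofNat (n + 1) i)).2

/-- The edges `01, 12, 34, 56, …` cover the vertices of a path with an even number of edges; this
is the smaller end of the `i`-th one, the first two being swapped if `b` holds. -/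
def coverStart (b : Bool) : ℕ → ℕ
  | 0 => if b then 1 else 0
  | 1 => if b then 0 else 1
  | i + 2 => 2 * i + 3

lemma coverStart_of_two_le (b : Bool) {i : ℕ} (hi : 2 ≤ i) : coverStart b i = 2 * i - 1 := by
  obtain ⟨k, rfl⟩ := Nat.exists_eq_add_of_le' hi
  simp only [coverStart]
  omega

lemma coverStart_zero_le (b : Bool) : coverStart b 0 ≤ 1 := by
  cases b <;> simp [coverStart]

lemma coverStart_succ_le (b : Bool) {i l : ℕ} (hi : i ≤ l) (hl : 1 ≤ l) :
    coverStart b i + 1 ≤ 2 * l := by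
  match i with
  | 0 => cases b <;> simp [coverStart] <;> omega
  | 1 => cases b <;> simp [coverStart] <;> omega
  | i + 2 => simp only [coverStart]; omega

lemma exists_coverStart (b : Bool) {n l : ℕ} (hn : n ≤ 2 * l) (hl : 1 ≤ l) :
    ∃ i ≤ l, n = coverStart b i ∨ n = coverStart b i + 1 := by
  rcases Nat.lt_or_ge n 3 with h | h
  · obtain hb | hb : (n = coverStart b 0 ∨ n = coverStart b 0 + 1) ∨
        (n = coverStart b 1 ∨ n = coverStart b 1 + 1) := by
      cases b <;> simp [coverStart] <;> omega
    · exact ⟨0, by omega, hb⟩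
    · exact ⟨1, hl, hb⟩
  · refine ⟨(n + 1) / 2, by omega, ?_⟩
    rw [coverStart_of_two_le b (by omega)]
    omega

/-- The edges of the path `p` listed by `coverStart`. -/
def coverEdges {V : Type*} (l : ℕ) (b : Bool) (p : ℕ → V) (i : Fin (l + 1)) : Sym2 V :=
  s(p (coverStart b i), p (coverStart b i + 1))

lemma exists_of_mem_coverEdges {V : Type*} {l : ℕ} {b : Bool} {p : ℕ → V} {i : Fin (l + 1)}
    {v : V} (h : v ∈ coverEdges l b p i) :
    ∃ n, (n = coverStart b i ∨ n = coverStart b i + 1) ∧ v = p n := by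
  rcases Sym2.mem_iff.1 h with h | h
  · exact ⟨_, Or.inl rfl, h⟩
  · exact ⟨_, Or.inr rfl, h⟩

lemma mem_coverEdges {V : Type*} {l : ℕ} {b : Bool} (p : ℕ → V) {i : Fin (l + 1)} {n : ℕ}
    (h : n = coverStart b i ∨ n = coverStart b i + 1) : p n ∈ coverEdges l b p i := by
  rcases h with rfl | rfl <;> simp [coverEdges]

lemma coverEdges_prefix_disjoint {V : Type*} {G : SimpleGraph V} {l : ℕ} {p q : ℕ → V}
    (hp : IsInducedPathSeq G (2 * l) p) (hq : IsInducedPathSeq G (2 * l) q) (b c : Bool)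
    (i j : Fin (l + 1)) (hi : 0 < i) (hij : i < j)
    (hpre : ∀ k < i, coverEdges l b p k = coverEdges l c q k) :
    coverEdges l b p i ≠ coverEdges l c q j := by
  intro heq
  have hi' : 0 < i.val := hi
  have hij' : i.val < j.val := hij
  have hjl : j.val ≤ l := Nat.lt_succ_iff.1 j.isLt
  have hj2 := coverStart_of_two_le c (show 2 ≤ j.val by omega)
  rcases Nat.lt_or_ge i.val 2 with h1 | h2
  · have hi1 : i.val = 1 := by omega
    have m0 : p 1 ∈ coverEdges l b p 0 :=
      mem_coverEdges p (by cases b <;> simp [coverStart])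
    have m1 : p 1 ∈ coverEdges l b p i :=
      mem_coverEdges p (by rw [hi1]; cases b <;> simp [coverStart])
    rw [hpre 0 hi] at m0
    rw [heq] at m1
    obtain ⟨x, hx, hpx⟩ := exists_of_mem_coverEdges m0
    obtain ⟨y, hy, hpy⟩ := exists_of_mem_coverEdges m1
    have hc := coverStart_zero_le c
    rw [Fin.val_zero] at hx
    have := (hq x (by omega) y (by omega)).1 (hpx.symm.trans hpy)
    omega
  · have mi : p (2 * i.val - 1) ∈ coverEdges l b p i :=
      mem_coverEdges p (Or.inl (coverStart_of_two_le b h2).symm)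
    rw [heq] at mi
    obtain ⟨y, hy, hpy⟩ := exists_of_mem_coverEdges mi
    obtain ⟨k, hk, hk'⟩ : ∃ k ≤ i.val - 1,
        2 * i.val - 2 = coverStart b k ∨ 2 * i.val - 2 = coverStart b k + 1 :=
      exists_coverStart b (by omega) (by omega)
    have mk : p (2 * i.val - 2) ∈ coverEdges l b p ⟨k, by omega⟩ := mem_coverEdges p hk'
    rw [hpre ⟨k, by omega⟩ (Fin.lt_def.2 (by simp only; omega))] at mk
    obtain ⟨x, hx, hpx⟩ := exists_of_mem_coverEdges mk
    have hkx := coverStart_succ_le c hk (by omega)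
    simp only at hx
    have hadj : G.Adj (p (2 * i.val - 2)) (p (2 * i.val - 1)) :=
      (hp _ (by omega) _ (by omega)).2.2 (by omega)
    rw [hpx, hpy, (hq x (by omega) y (by omega)).2] at hadj
    omega

lemma mem_range_of_coverEdges_eq {V : Type*} {l : ℕ} (hl : 1 ≤ l) {p q : ℕ → V} {b c : Bool}
    (h : coverEdges l b p = coverEdges l c q) {n : ℕ} (hn : n ≤ 2 * l) :
    ∃ k ≤ 2 * l, q k = p n := by
  obtain ⟨i, hi, hni⟩ := exists_coverStart b hn hl
  have hm : p n ∈ coverEdges l b p ⟨i, by omega⟩ := mem_coverEdges p hni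
  rw [h] at hm
  obtain ⟨k, hk, hpk⟩ := exists_of_mem_coverEdges hm
  have := coverStart_succ_le c hi hl
  simp only at hk
  exact ⟨k, by omega, hpk.symm⟩

/-- The path `p`, reversed if `r` holds. -/
def orientSeq {V : Type*} (n : ℕ) (r : Bool) (p : ℕ → V) : ℕ → V :=
  fun i => if r then p (n - i) else p i

lemma IsInducedPathSeq.orientSeq {V : Type*} {G : SimpleGraph V} {n : ℕ} {p : ℕ → V}
    (hp : IsInducedPathSeq G n p) (r : Bool) : IsInducedPathSeq G n (orientSeq n r p) := by
  cases r
  · exact hp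
  · exact hp.reverse

lemma exists_orientSeq {V : Type*} {n : ℕ} {p : ℕ → V} (r : Bool) (v : V) :
    (∃ i ≤ n, orientSeq n r p i = v) ↔ ∃ i ≤ n, p i = v := by
  cases r
  · rfl
  · constructor
    · rintro ⟨i, _, h⟩
      exact ⟨n - i, by omega, h⟩
    · rintro ⟨i, hi, h⟩
      exact ⟨n - i, by omega, by simpa [orientSeq, Nat.sub_sub_self hi] using h⟩

lemma coverEdges_orientSeq_injective {V : Type*} {G : SimpleGraph V} {l : ℕ} (hl : 2 ≤ l)
    {p : ℕ → V} (hp : IsInducedPathSeq G (2 * l) p) {b c r s : Bool}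
    (h : coverEdges l b (orientSeq (2 * l) r p) = coverEdges l c (orientSeq (2 * l) s p)) :
    b = c ∧ r = s := by
  have h0 := congrFun h 0
  have inj : ∀ i ≤ 2 * l, ∀ j ≤ 2 * l, p i = p j → i = j := fun i hi j hj => (hp i hi j hj).1
  simp only [coverEdges, Fin.val_zero, Sym2.eq_iff] at h0
  have hb := coverStart_zero_le b
  have hc := coverStart_zero_le c
  have hbc : coverStart b 0 = coverStart c 0 → b = c := by
    cases b <;> cases c <;> simp [coverStart]
  cases r <;> cases s <;> simp only [orientSeq, if_true, if_false, Bool.false_eq_true] at h0 <;>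
    rcases h0 with ⟨h1, h2⟩ | ⟨h1, h2⟩ <;>
    replace h1 := inj _ (by omega) _ (by omega) h1 <;>
    replace h2 := inj _ (by omega) _ (by omega) h2 <;>
    first
    | exact ⟨hbc (by omega), rfl⟩
    | (exfalso; omega)

theorem odd_path_upper_bound (l : ℕ) (hl : 2 ≤ l) {V : Type*} [Fintype V]
    (G : SimpleGraph V) (m : ℕ) (hG : G.edgeSet.ncard = m) :
    (inducedCopies G (SimpleGraph.pathGraph (2 * l + 1)) : ℝ) ≤
      (m : ℝ) ^ (l + 1) / (4 * (l : ℝ) ^ l) := by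
  classical
  unfold inducedCopies
  rw [Set.ncard_eq_toFinset_card']
  set C : Finset (Finset V) := Set.toFinset
    {S : Finset V | Nonempty ((G.induce (S : Set V)) ≃g SimpleGraph.pathGraph (2 * l + 1))}
  have hC : ∀ S ∈ C, ∃ p : ℕ → V,
      IsInducedPathSeq G (2 * l) p ∧ ∀ v, v ∈ S ↔ ∃ i ≤ 2 * l, p i = v :=
    fun S hS => exists_isInducedPathSeq G (2 * l) S (by simpa [C] using hS)
  rcases isEmpty_or_nonempty V with hV | hV
  · have : C = ∅ := Finset.eq_empty_of_forall_notMem fun S hS =>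
      let ⟨p, _⟩ := hC S hS
      hV.false (p 0)
    rw [this, Finset.card_empty, Nat.cast_zero]
    positivity
  choose! p hp using hC
  let F : Finset V × Bool × Bool → Fin (l + 1) → Sym2 V :=
    fun x => coverEdges l x.2.1 (orientSeq (2 * l) x.2.2 (p x.1))
  have hF : Set.InjOn F ((C ×ˢ Finset.univ : Finset (Finset V × Bool × Bool)) : Set _) := by
    rintro ⟨S, b, r⟩ hx ⟨S', c, s⟩ hy h
    simp only [Finset.coe_product, Set.mem_prod, Finset.mem_coe] at hx hy
    obtain ⟨hpS, hvS⟩ := hp S hx.1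
    obtain ⟨hpS', hvS'⟩ := hp S' hy.1
    have hSS : S = S' := by
      ext v
      rw [hvS, hvS', ← exists_orientSeq (p := p S) r, ← exists_orientSeq (p := p S') s]
      constructor
      · rintro ⟨n, hn, rfl⟩
        exact mem_range_of_coverEdges_eq (by omega) h hn
      · rintro ⟨n, hn, rfl⟩
        exact mem_range_of_coverEdges_eq (by omega) h.symm hn
    subst hSS
    obtain ⟨rfl, rfl⟩ := coverEdges_orientSeq_injective hl hpS h
    rfl
  have key := card_mul_pow_le_of_prefix_disjoint_tail l
    ((C ×ˢ (Finset.univ : Finset (Bool × Bool))).image F) G.edgeSet.toFinset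
    (by
      intro t ht i
      obtain ⟨⟨S, b, r⟩, hx, rfl⟩ := Finset.mem_image.1 ht
      have hq := (hp S (Finset.mem_product.1 hx).1).1.orientSeq r
      have hi := coverStart_succ_le b (Nat.lt_succ_iff.1 i.isLt) (show 1 ≤ l by omega)
      exact Set.mem_toFinset.2 ((hq _ (Nat.le_of_succ_le hi) _ hi).2.2 (Or.inl rfl)))
    (by
      intro s hs t ht i j hi hij hk
      obtain ⟨⟨S, b, r⟩, hx, rfl⟩ := Finset.mem_image.1 hs
      obtain ⟨⟨S', c, r'⟩, hy, rfl⟩ := Finset.mem_image.1 ht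
      exact coverEdges_prefix_disjoint ((hp S (Finset.mem_product.1 hx).1).1.orientSeq r)
        ((hp S' (Finset.mem_product.1 hy).1).1.orientSeq r') b c i j hi hij hk)
  rw [Finset.card_image_of_injOn hF, Finset.card_product, ← Set.ncard_eq_toFinset_card' G.edgeSet, hG] at key
  have h4 : (Finset.univ : Finset (Bool × Bool)).card = 4 := rfl
  rw [h4] at key
  have hl' : (0 : ℝ) < l := by exact_mod_cast (show 0 < l by omega)
  rw [le_div_iff₀ (by positivity), ← mul_assoc]
  exact_mod_cast key
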